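/- Let χ²_j denote a chi-square random variable with j degrees of freedom. If c → ∞ and J/c → 0, then P(χ²_j > c) = (1/Γ(j/2)) · (c/2)^{j/2 − 1} · exp(−c/2) · (1 + o(1)) uniformly for all positive integers j ≤ J; that is, sup_{1 ≤ j ≤ J} | P(χ²_j > c) / [ (1/Γ(j/2)) (c/2)^{j/2−1} e^{−c/2} ] − 1 | → 0 along any sequence (c, J) with c → ∞ and J/c → 0. -/

import Mathlib

open MeasureTheory ProbabilityTheory Filter Real

/-- The chi-square distribution with `j` degrees of freedom, i.e. the Gamma
distribution with shape `j/2` and rate `1/2`. -/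
noncomputable def chiSqMeasure (j : ℕ) : Measure ℝ :=
  gammaMeasure ((j : ℝ) / 2) (1 / 2)

lemma pdf_bounds {a c x m : ℝ} (ha : 0 < a) (hc : 0 < c) (hx : c < x) (hm : |a - 1| ≤ m) :
    gammaPDFReal a (1/2) c * exp (-(1/2 + m / c) * (x - c)) ≤ gammaPDFReal a (1/2) x ∧
    gammaPDFReal a (1/2) x ≤ gammaPDFReal a (1/2) c * exp (-(1/2 - m / c) * (x - c)) := by
  have hx0 : 0 < x := hc.trans hx
  have hK : 0 < (1/2 : ℝ) ^ a / Real.Gamma a := by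
    have := Real.Gamma_pos_of_pos ha
    positivity
  have hl0 : 0 ≤ Real.log (x / c) := Real.log_nonneg (by rw [le_div_iff₀ hc]; linarith)
  have hl1 : Real.log (x / c) ≤ (x - c) / c := by
    have := Real.log_le_sub_one_of_pos (div_pos hx0 hc)
    rwa [sub_div, div_self hc.ne']
  have hlog : Real.log (x / c) = Real.log x - Real.log c := Real.log_div hx0.ne' hc.ne'
  have hm0 : 0 ≤ m := (abs_nonneg _).trans hm
  have hab : |(a - 1) * Real.log (x / c)| ≤ m * ((x - c) / c) := by
    rw [abs_mul, abs_of_nonneg hl0]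
    exact mul_le_mul hm hl1 hl0 hm0
  have h1 := (abs_le.mp hab).1
  have h2 := (abs_le.mp hab).2
  rw [hlog] at h1 h2
  have e : m / c * (x - c) = m * ((x - c) / c) := by ring
  simp only [gammaPDFReal, if_pos hx0.le, if_pos hc.le, Real.rpow_def_of_pos hx0,
    Real.rpow_def_of_pos hc]
  constructor
  · rw [mul_assoc, mul_assoc, mul_assoc, ← Real.exp_add, ← Real.exp_add, ← Real.exp_add]
    refine mul_le_mul_of_nonneg_left (Real.exp_le_exp.mpr ?_) hK.le
    nlinarith
  · rw [mul_assoc, mul_assoc, mul_assoc, ← Real.exp_add, ← Real.exp_add, ← Real.exp_add]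
    refine mul_le_mul_of_nonneg_left (Real.exp_le_exp.mpr ?_) hK.le
    nlinarith

lemma exp_int {b : ℝ} (hb : 0 < b) (K c : ℝ) :
    IntegrableOn (fun x => K * exp (-b * (x - c))) (Set.Ioi c) ∧
    ∫ x in Set.Ioi c, K * exp (-b * (x - c)) = K / b := by
  have e : (fun x => K * exp (-b * (x - c))) = fun x => (K * exp (b * c)) * exp (-b * x) := by
    funext x
    rw [mul_assoc, ← Real.exp_add]; congr 2; ring
  rw [e]
  refine ⟨(integrableOn_exp_mul_Ioi (by linarith) c).const_mul _, ?_⟩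
  rw [integral_const_mul, integral_exp_mul_Ioi (by linarith), mul_assoc, mul_div_assoc', mul_neg, ← Real.exp_add]
  simp
  field_simp

lemma tail_eq (a c : ℝ) (ha : 0 < a) :
    (gammaMeasure a (1/2) {x : ℝ | c < x}).toReal = ∫ x in Set.Ioi c, gammaPDFReal a (1/2) x := by
  change (gammaMeasure a (1/2) (Set.Ioi c)).toReal = _
  rw [gammaMeasure, withDensity_apply _ measurableSet_Ioi, integral_eq_lintegral_of_nonneg_ae
    (ae_of_all _ (gammaPDFReal_nonneg ha (by norm_num)))
    (measurable_gammaPDFReal _ _).aestronglyMeasurable]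
  rfl

lemma tail_bounds {a c m : ℝ} (ha : 0 < a) (hc : 0 < c) (hm : |a - 1| ≤ m) (hmc : m / c < 1/2) :
    gammaPDFReal a (1/2) c / (1/2 + m / c) ≤ (gammaMeasure a (1/2) {x : ℝ | c < x}).toReal ∧
    (gammaMeasure a (1/2) {x : ℝ | c < x}).toReal ≤ gammaPDFReal a (1/2) c / (1/2 - m / c) := by
  have hm0 : 0 ≤ m / c := div_nonneg ((abs_nonneg _).trans hm) hc.le
  obtain ⟨i1, e1⟩ := exp_int (b := 1/2 + m / c) (by linarith) (gammaPDFReal a (1/2) c) c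
  obtain ⟨i2, e2⟩ := exp_int (b := 1/2 - m / c) (by linarith) (gammaPDFReal a (1/2) c) c
  have i : IntegrableOn (gammaPDFReal a (1/2)) (Set.Ioi c) := by
    refine Integrable.mono' i2 (measurable_gammaPDFReal _ _).aestronglyMeasurable ?_
    filter_upwards [ae_restrict_mem measurableSet_Ioi] with x hx
    rw [Real.norm_of_nonneg (gammaPDFReal_nonneg ha (by norm_num) x)]
    exact (pdf_bounds ha hc hx hm).2
  rw [tail_eq a c ha, ← e1, ← e2]
  exact ⟨setIntegral_mono_on i1 i measurableSet_Ioi fun x hx => (pdf_bounds ha hc hx hm).1,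
    setIntegral_mono_on i i2 measurableSet_Ioi fun x hx => (pdf_bounds ha hc hx hm).2⟩

lemma approx_eq {a c : ℝ} (hc : 0 < c) :
    (1 / Real.Gamma a) * (c / 2) ^ (a - 1) * Real.exp (-c / 2) = 2 * gammaPDFReal a (1/2) c := by
  simp only [gammaPDFReal, if_pos hc.le]
  have h : (1/2 : ℝ) ^ a = (1/2) ^ (a - 1) * (1/2) := by
    rw [Real.rpow_sub_one (by norm_num)]; ring
  have h2 : (c / 2) ^ (a - 1) = c ^ (a - 1) * (1/2) ^ (a - 1) := by
    rw [← Real.mul_rpow hc.le (by norm_num)]; congr 1; ring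
  have h3 : -c / 2 = -(1 / 2 * c) := by ring
  rw [h, h2, h3]; ring

theorem chiSq_tail_uniform (c : ℕ → ℝ) (J : ℕ → ℕ)
    (hc : Tendsto c atTop atTop)
    (hJc : Tendsto (fun n => (J n : ℝ) / c n) atTop (nhds 0)) :
    ∀ ε : ℝ, 0 < ε → ∀ᶠ n in atTop, ∀ j : ℕ, 1 ≤ j → j ≤ J n →
      |(chiSqMeasure j {x : ℝ | c n < x}).toReal /
          ((1 / Real.Gamma ((j : ℝ) / 2)) * (c n / 2) ^ ((j : ℝ) / 2 - 1) *
            Real.exp (-(c n) / 2)) - 1| < ε := by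
  intro ε hε
  filter_upwards [hc.eventually_gt_atTop 0,
    hJc.eventually_lt_const (u := min (1/2) (ε/2)) (by positivity)] with n hcn hn j hj hjJ
  obtain ⟨hn1, hn2⟩ := lt_min_iff.mp hn
  have hj1 : (1 : ℝ) ≤ j := by exact_mod_cast hj
  have hjJ' : (j : ℝ) ≤ J n := by exact_mod_cast hjJ
  have ha : 0 < (j : ℝ) / 2 := by linarith
  have hm : |(j : ℝ) / 2 - 1| ≤ (J n : ℝ) / 2 := by
    rw [abs_le]; constructor <;> linarith
  set η := (J n : ℝ) / c n with hη
  have hη0 : 0 ≤ η := by positivity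
  have hmc : (J n : ℝ) / 2 / c n = η / 2 := by rw [hη]; ring
  obtain ⟨l, u⟩ := tail_bounds ha hcn hm (by rw [hmc]; linarith)
  rw [approx_eq hcn]
  rw [hmc] at l u
  change |(gammaMeasure ((j : ℝ) / 2) (1/2) {x : ℝ | c n < x}).toReal / _ - 1| < ε
  have hf := gammaPDFReal_pos (r := 1/2) ha (by norm_num) hcn
  generalize (gammaMeasure ((j : ℝ) / 2) (1/2) {x : ℝ | c n < x}).toReal = T at *
  generalize gammaPDFReal ((j : ℝ) / 2) (1/2) (c n) = f at *
  rw [div_le_iff₀ (by linarith)] at l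
  rw [le_div_iff₀ (by linarith)] at u
  obtain ⟨R, rfl⟩ : ∃ R, T = R * (2 * f) := ⟨T / (2 * f), by field_simp⟩
  rw [mul_div_cancel_right₀ _ (by positivity)]
  have l' : 1 ≤ R * (1 + η) := by
    refine le_of_mul_le_mul_right ?_ hf
    linarith
  have u' : R * (1 - η) ≤ 1 := by
    refine le_of_mul_le_mul_right ?_ hf
    linarith
  have hR2 : R ≤ 2 := by nlinarith
  have hR0 : 0 < R := by
    by_contra h
    nlinarith
  rw [abs_lt]
  constructor <;> nlinarith
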